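/- arXiv:1102.4588 — 2 statements merged into one kernel-verified Lean document; each statement's English description precedes it below -/
import Mathlib

section
/- Let d be a degeneration vector for Λ. Then every point (0, u₁,…,uₙ) of W̄₀(Λ,d) satisfies the first-order equations: for every (a,b,c) ∈ Λ, u₁^{a₁}⋯uₙ^{aₙ}·∏_{i : dᵢ=0}(1−uᵢ)^{bᵢ} = (−1)^c. -/
open scoped BigOperators

/-- The ambient lattice `ℤ^(2n+1)`, with elements written `(a, b, c)`. -/
abbrev GlueVec (n : ℕ) := (Fin n → ℤ) × (Fin n → ℤ) × ℤ

/-- The variety of gluing equation type `V(Λ)`: points `z ∈ (ℂ∖{0,1})^n` with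
`∏ zᵢ^{aᵢ} · ∏ (1-zᵢ)^{bᵢ} = (-1)^c` for all `(a,b,c) ∈ Λ`. -/
def glueVariety (n : ℕ) (Λ : Submodule ℤ (GlueVec n)) : Set (Fin n → ℂ) :=
  {z | (∀ i, z i ≠ 0 ∧ z i ≠ 1) ∧
    ∀ v ∈ Λ, (∏ i, z i ^ v.1 i) * (∏ i, (1 - z i) ^ v.2.1 i) = (-1 : ℂ) ^ v.2.2}

/-- `d` is a degeneration vector for `Λ`: nonzero, nonnegative (automatic as `d : Fin n → ℕ`),
with `∑ aᵢ dᵢ = 0` for all `(a,b,c) ∈ Λ`. -/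
def IsDegVec (n : ℕ) (Λ : Submodule ℤ (GlueVec n)) (d : Fin n → ℕ) : Prop :=
  d ≠ 0 ∧ ∀ v ∈ Λ, ∑ i, v.1 i * (d i : ℤ) = 0

/-- `d` is genuine: there are holomorphic functions `uᵢ` on a disc of radius `ε` about `0`,
with `uᵢ(0) ≠ 0`, and `uᵢ(0) ≠ 1` whenever `dᵢ = 0`, such that
`(t^{d₁}u₁(t), …, t^{dₙ}uₙ(t)) ∈ V(Λ)` for all `0 < |t| < ε`. -/
def IsGenuine (n : ℕ) (Λ : Submodule ℤ (GlueVec n)) (d : Fin n → ℕ) : Prop :=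
  ∃ ε : ℝ, 0 < ε ∧ ∃ u : Fin n → (ℂ → ℂ),
    (∀ i, DifferentiableOn ℂ (u i) (Metric.ball (0 : ℂ) ε)) ∧
    (∀ i, u i 0 ≠ 0) ∧
    (∀ i, d i = 0 → u i 0 ≠ 1) ∧
    ∀ t : ℂ, 0 < ‖t‖ → ‖t‖ < ε → (fun i => t ^ (d i) * u i t) ∈ glueVariety n Λ

/-- The set `Ū = {(t,u) ∈ ℂ × (ℂ∖{0})^n : t^{dᵢ} uᵢ ≠ 1 for all i}`. -/
def Ubar (n : ℕ) (d : Fin n → ℕ) : Set (ℂ × (Fin n → ℂ)) :=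
  {p | (∀ i, p.2 i ≠ 0) ∧ ∀ i, p.1 ^ (d i) * p.2 i ≠ 1}

/-- The set `W(Λ,d) = {(t,u) ∈ Ū : t ≠ 0 and (t^{d₁}u₁, …, t^{dₙ}uₙ) ∈ V(Λ)}`. -/
def Wset (n : ℕ) (Λ : Submodule ℤ (GlueVec n)) (d : Fin n → ℕ) : Set (ℂ × (Fin n → ℂ)) :=
  {p ∈ Ubar n d | p.1 ≠ 0 ∧ (fun i => p.1 ^ (d i) * p.2 i) ∈ glueVariety n Λ}

/-- `W̄(Λ,d)`, the closure of `W(Λ,d)` in `Ū` (with the subspace topology, i.e. the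
intersection of the ambient closure with `Ū`). -/
def Wbar (n : ℕ) (Λ : Submodule ℤ (GlueVec n)) (d : Fin n → ℕ) : Set (ℂ × (Fin n → ℂ)) :=
  closure (Wset n Λ d) ∩ Ubar n d

/-- `W̄₀(Λ,d) = W̄(Λ,d) ∩ {t = 0}`. -/
def WbarZero (n : ℕ) (Λ : Submodule ℤ (GlueVec n)) (d : Fin n → ℕ) : Set (ℂ × (Fin n → ℂ)) :=
  Wbar n Λ d ∩ {p | p.1 = 0}

/-- The left-hand side of a gluing equation for `z = (t^{d₁}u₁, …, t^{dₙ}uₙ)`, with the factor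
`t^{∑ aᵢ dᵢ}` removed. -/
noncomputable def reducedGlueMonomial (n : ℕ) (d : Fin n → ℕ) (v : GlueVec n)
    (q : ℂ × (Fin n → ℂ)) : ℂ :=
  (∏ i, q.2 i ^ v.1 i) * ∏ i, (1 - q.1 ^ d i * q.2 i) ^ v.2.1 i

theorem reducedGlueMonomial_continuousAt {n : ℕ} {d : Fin n → ℕ} (v : GlueVec n)
    {p : ℂ × (Fin n → ℂ)} (hp : p ∈ Ubar n d) :
    ContinuousAt (reducedGlueMonomial n d v) p := by
  unfold reducedGlueMonomial
  refine ContinuousAt.mul (tendsto_finsetProd _ fun i _ => ?_) (tendsto_finsetProd _ fun i _ => ?_)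
  · exact ContinuousAt.zpow₀ (by fun_prop) _ (Or.inl (hp.1 i))
  · exact ContinuousAt.zpow₀ (by fun_prop) _ (Or.inl (sub_ne_zero.2 (hp.2 i).symm))

theorem prod_zpow_eq_zpow_sum_of_ne_zero {ι K : Type*} [Field K] {t : K} (ht : t ≠ 0)
    (s : Finset ι) (f : ι → ℤ) : ∏ i ∈ s, t ^ f i = t ^ ∑ i ∈ s, f i := by
  classical
  induction s using Finset.induction_on with
  | empty => simp
  | insert i s hi ih => rw [Finset.prod_insert hi, Finset.sum_insert hi, ih, zpow_add₀ ht]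

theorem prod_pow_mul_zpow_of_sum_eq_zero {ι K : Type*} [Fintype ι] [Field K] {t : K} (ht : t ≠ 0)
    (u : ι → K) {a : ι → ℤ} {d : ι → ℕ} (h : ∑ i, a i * (d i : ℤ) = 0) :
    ∏ i, (t ^ d i * u i) ^ a i = ∏ i, u i ^ a i := by
  have key : ∏ i, t ^ (a i * (d i : ℤ)) = 1 := by
    rw [prod_zpow_eq_zpow_sum_of_ne_zero ht, h, zpow_zero]
  calc ∏ i, (t ^ d i * u i) ^ a i = ∏ i, t ^ (a i * (d i : ℤ)) * u i ^ a i := by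
        refine Finset.prod_congr rfl fun i _ => ?_
        rw [mul_zpow, mul_comm (a i), zpow_mul, zpow_natCast]
    _ = ∏ i, u i ^ a i := by rw [Finset.prod_mul_distrib, key, one_mul]

theorem reducedGlueMonomial_eq_of_mem_Wset {n : ℕ} {Λ : Submodule ℤ (GlueVec n)} {d : Fin n → ℕ}
    (hd : IsDegVec n Λ d) {v : GlueVec n} (hv : v ∈ Λ) {q : ℂ × (Fin n → ℂ)}
    (hq : q ∈ Wset n Λ d) : reducedGlueMonomial n d v q = (-1 : ℂ) ^ v.2.2 := by
  obtain ⟨-, ht, -, hV⟩ := hq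
  rw [← hV v hv, reducedGlueMonomial, prod_pow_mul_zpow_of_sum_eq_zero ht q.2 (hd.2 v hv)]

theorem reducedGlueMonomial_of_fst_eq_zero {n : ℕ} (d : Fin n → ℕ) (v : GlueVec n)
    {p : ℂ × (Fin n → ℂ)} (hp : p.1 = 0) :
    reducedGlueMonomial n d v p = (∏ i, p.2 i ^ v.1 i) *
      ∏ i ∈ Finset.univ.filter (fun i => d i = 0), (1 - p.2 i) ^ v.2.1 i := by
  rw [reducedGlueMonomial, Finset.prod_filter]
  congr 1
  refine Finset.prod_congr rfl fun i _ => ?_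
  by_cases h : d i = 0 <;> simp [h, hp]

/-- Every point `(0, u)` of `W̄₀(Λ,d)` satisfies the first-order equations:
for all `(a,b,c) ∈ Λ`, `∏ᵢ uᵢ^{aᵢ} · ∏_{i : dᵢ = 0} (1-uᵢ)^{bᵢ} = (-1)^c`. -/
theorem WbarZero_satisfies_first_order (n : ℕ) (hn : 1 ≤ n)
    (Λ : Submodule ℤ (GlueVec n)) (d : Fin n → ℕ) (hd : IsDegVec n Λ d)
    (p : ℂ × (Fin n → ℂ)) (hp : p ∈ WbarZero n Λ d) :
    ∀ v ∈ Λ, (∏ i, p.2 i ^ v.1 i) *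
      (∏ i ∈ Finset.univ.filter (fun i => d i = 0), (1 - p.2 i) ^ v.2.1 i)
      = (-1 : ℂ) ^ v.2.2 := by
  intro v hv
  obtain ⟨⟨hcl, hU⟩, h0⟩ := hp
  rw [← reducedGlueMonomial_of_fst_eq_zero d v h0]
  have hmem := (reducedGlueMonomial_continuousAt v hU).continuousWithinAt.mem_closure hcl
    (fun q hq => Set.mem_singleton_iff.2 (reducedGlueMonomial_eq_of_mem_Wset hd hv hq))
  simpa using hmem
end

section
/- Let n ≥ 1, let P be a prime ideal of the polynomial ring ℂ[x₁,…,xₙ], and let Y = {z ∈ ℂⁿ : f(z) = 0 for all f ∈ P} be its zero set. Suppose the coordinate function x₁ is nonconstant on Y (i.e., there are points y, y′ ∈ Y with y₁ ≠ y′₁), and let p ∈ Y be a point with p₁ = 0. Then there exists a prime ideal P′ of ℂ[x₁,…,xₙ] containing P such that the quotient ring ℂ[x₁,…,xₙ]/P′ has Krull dimension 1, the point p lies in the zero set C of P′ (so p ∈ C ⊆ Y), and the coordinate x₁ is nonconstant on C. -/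
/-- Every maximal ideal of a polynomial ring in `s` variables over a field has height `s`. -/
theorem MvPolynomial.height_eq_of_isMaximal {k : Type*} [Field k] (s : ℕ)
    (M : Ideal (MvPolynomial (Fin s) k)) [hM : M.IsMaximal] : M.height = s := by
  induction s with
  | zero =>
    refine le_antisymm ?_ (by simp)
    have h := Ideal.height_le_ringKrullDim_of_ne_top hM.ne_top
    rw [MvPolynomial.ringKrullDim_of_isNoetherianRing] at h
    simpa using h
  | succ s ih =>
    let e := (MvPolynomial.finSuccEquiv k s).toRingEquiv
    let N : Ideal (Polynomial (MvPolynomial (Fin s) k)) := M.map e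
    have hN : N.IsMaximal := Ideal.map_isMaximal_of_equiv e
    have hC : (N.under (MvPolynomial (Fin s) k)).IsMaximal :=
      Polynomial.isMaximal_comap_C_of_isJacobsonRing N
    have hover : N.LiesOver (N.under (MvPolynomial (Fin s) k)) := ⟨rfl⟩
    rw [← e.height_map M,
      Polynomial.height_eq_height_add_one (N.under (MvPolynomial (Fin s) k)) N, ih]
    simp

/-- Heights do not increase under contraction to a subring over which the ring is integral. -/
theorem Ideal.height_le_height_under_of_isIntegral {R S : Type*} [CommRing R] [CommRing S]
    [Algebra R S] [Algebra.IsIntegral R S] (M : Ideal S) [M.IsPrime] :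
    M.height ≤ (M.under R).height := by
  rw [(⟨M, ‹_›⟩ : PrimeSpectrum S).height_eq_orderHeight,
    (⟨M.under R, inferInstance⟩ : PrimeSpectrum R).height_eq_orderHeight]
  refine Order.height_le_height_apply_of_strictMono (PrimeSpectrum.comap (algebraMap R S)) ?_ _
  intro I J h
  exact Ideal.IsIntegral.comap_lt_comap (R := R) (show I.asIdeal < J.asIdeal from h)

/-- The Krull dimension of a finitely generated domain over a field is the height of any of its
maximal ideals. -/
theorem Ideal.IsMaximal.height_eq_ringKrullDim (k : Type*) [Field k] {A : Type*} [CommRing A]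
    [IsDomain A] [Algebra k A] [Algebra.FiniteType k A] (m : Ideal A) [m.IsMaximal] :
    (m.height : WithBot ℕ∞) = ringKrullDim A := by
  refine le_antisymm (Ideal.height_le_ringKrullDim_of_ne_top Ideal.IsPrime.ne_top') ?_
  rw [ringKrullDim_le_iff_isMaximal_height_le]
  intro M hM
  obtain ⟨s, g, hg, hint⟩ := exists_integral_inj_algHom_of_fg k A
  algebraize [g.toRingHom]
  have : FaithfulSMul (MvPolynomial (Fin s) k) A :=
    (faithfulSMul_iff_algebraMap_injective _ _).mpr hg
  have : IsNoetherianRing A := Algebra.FiniteType.isNoetherianRing k A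
  have hmax (I : Ideal A) [I.IsMaximal] : (I.under (MvPolynomial (Fin s) k)).IsMaximal :=
    Ideal.isMaximal_comap_of_isIntegral_of_isMaximal I
  have := hmax m
  have := hmax M
  have h1 := Ideal.height_le_height_under_of_isIntegral (R := MvPolynomial (Fin s) k) M
  have h2 := Ideal.height_eq_height_add_of_liesOver_of_hasGoingDown
    (m.under (MvPolynomial (Fin s) k)) m
  rw [MvPolynomial.height_eq_of_isMaximal] at h1 h2
  exact_mod_cast h1.trans (h2 ▸ le_self_add)

/-- In a Noetherian domain, a prime ideal has height at most one if some element belongs to all the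
nonzero primes below it. -/
theorem Ideal.height_le_one_of_forall_mem {A : Type*} [CommRing A] [IsDomain A]
    [IsNoetherianRing A] (m : Ideal A) [hm : m.IsPrime] {f : A} (hf : f ≠ 0)
    (h : ∀ q : Ideal A, q.IsPrime → q ≠ ⊥ → q ≤ m → f ∈ q) : m.height ≤ 1 := by
  by_cases hmin : m ∈ (Ideal.span {f}).minimalPrimes
  · exact Ideal.height_le_one_of_isPrincipal_of_mem_minimalPrimes _ m hmin
  by_cases hbot : m = ⊥
  · simp [hbot]
  have hfm : f ∈ m := h m hm hbot le_rfl
  have key : ¬ (m : Set A) ⊆ ⋃ q ∈ {q ∈ (Ideal.span {f}).minimalPrimes | q ≤ m}, (q : Set A) := by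
    intro hsub
    obtain ⟨q, ⟨hq, hqm⟩, hmq⟩ := (Ideal.subset_union_prime_finite
      (((Ideal.span {f}).finite_minimalPrimes_of_isNoetherianRing A).subset fun _ hq ↦ hq.1)
      (f := id) 0 0 fun _ hq _ _ ↦ hq.1.1.1).1 hsub
    exact hmin (le_antisymm hqm hmq ▸ hq)
  obtain ⟨g, hgm, hg⟩ := Set.not_subset.mp key
  simp only [Set.mem_iUnion, not_exists] at hg
  obtain ⟨q, hq, hqm⟩ := Ideal.exists_minimalPrimes_le
    ((Ideal.span_singleton_le_iff_mem m).mpr hgm)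
  have hqp : q.IsPrime := hq.1.1
  have hgq : g ∈ q := (Ideal.span_singleton_le_iff_mem q).mp hq.1.2
  have hfq {q : Ideal A} (hqp : q.IsPrime) (hqm : q ≤ m) (hq : q ≠ ⊥) : span {f} ≤ q :=
    (Ideal.span_singleton_le_iff_mem q).mpr (h q hqp hq hqm)
  obtain ⟨r₀, hr₀, hr₀m⟩ := Ideal.exists_minimalPrimes_le
    ((Ideal.span_singleton_le_iff_mem m).mpr hfm)
  have hg0 : g ≠ 0 := by
    rintro rfl
    exact hg r₀ ⟨hr₀, hr₀m⟩ r₀.zero_mem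
  have hqbot : q ≠ ⊥ := by
    rintro rfl
    exact hg0 (by simpa using hgq)
  obtain ⟨r, hr, hrq⟩ := Ideal.exists_minimalPrimes_le (hfq hqp hqm hqbot)
  have hrp : r.IsPrime := hr.1.1
  have hlt : r < q := lt_of_le_of_ne hrq fun e ↦ hg r ⟨hr, hrq.trans hqm⟩ (e ▸ hgq)
  have hrbot : r.height ≠ 0 := by
    rw [Ne, Ideal.height_eq_zero_iff_eq_bot]
    rintro rfl
    exact hf (by simpa using hr.1.2)
  have hq1 := Ideal.height_le_one_of_isPrincipal_of_mem_minimalPrimes _ q hq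
  have h0 := (Ideal.height_le_iff (p := q) (n := 1)).mp (by exact_mod_cast hq1) r hrp hlt
  exact absurd (by simpa [Order.lt_one_iff] using h0) hrbot

/-- Let `P ≤ m` be prime ideals of a finitely generated algebra over a field, with `m` maximal, and
let `f ∈ m` with `f ∉ P`. Then there is a prime `Q` with `P ≤ Q ≤ m` and `f ∉ Q` whose quotient has
Krull dimension one. -/
theorem Ideal.exists_isPrime_notMem_ringKrullDim_quotient_eq_one (k : Type*) [Field k]
    {A : Type*} [CommRing A] [Algebra k A] [Algebra.FiniteType k A] {P m : Ideal A}
    (hP : P.IsPrime) (hm : m.IsMaximal) (hPm : P ≤ m) {f : A} (hfm : f ∈ m) (hfP : f ∉ P) :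
    ∃ Q : Ideal A, Q.IsPrime ∧ P ≤ Q ∧ Q ≤ m ∧ f ∉ Q ∧ ringKrullDim (A ⧸ Q) = 1 := by
  have : IsNoetherianRing A := Algebra.FiniteType.isNoetherianRing k A
  obtain ⟨Q, ⟨hQ, hPQ, hQm, hfQ⟩, hmax⟩ := set_has_maximal_iff_noetherian.mpr ‹_›
    {Q : Ideal A | Q.IsPrime ∧ P ≤ Q ∧ Q ≤ m ∧ f ∉ Q} ⟨P, hP, le_rfl, hPm, hfP⟩
  refine ⟨Q, hQ, hPQ, hQm, hfQ, ?_⟩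
  let π := Ideal.Quotient.mk Q
  have hcomap : (m.map π).comap π = m := by
    rw [Ideal.comap_map_of_surjective _ Ideal.Quotient.mk_surjective, ← RingHom.ker_eq_comap_bot,
      Ideal.mk_ker, sup_eq_left.mpr hQm]
  have hmm : (m.map π).IsMaximal :=
    .map_of_surjective_of_ker_le Ideal.Quotient.mk_surjective (by simpa [π] using hQm)
  have hf0 : π f ≠ 0 := by rwa [Ne, Ideal.Quotient.eq_zero_iff_mem]
  have hle : (m.map π).height ≤ 1 := by
    refine Ideal.height_le_one_of_forall_mem _ hf0 fun q hq hqbot hqm ↦ ?_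
    by_contra hfq
    have hQq : Q ≤ q.comap π := by
      simpa [π] using Ideal.ker_le_comap (K := q) π
    refine hmax (q.comap π) ⟨hq.comap π, hPQ.trans hQq,
      (Ideal.comap_mono hqm).trans_eq hcomap, hfq⟩ (lt_of_le_of_ne hQq fun e ↦ hqbot ?_)
    rw [← Ideal.map_comap_of_surjective π Ideal.Quotient.mk_surjective q, ← e,
      Ideal.map_quotient_self]
  have hne : (m.map π).height ≠ 0 := by
    rw [Ne, Ideal.height_eq_zero_iff_eq_bot]
    intro h
    exact hf0 (by simpa [h] using Ideal.mem_map_of_mem π hfm)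
  rw [← Ideal.IsMaximal.height_eq_ringKrullDim k (m.map π)]
  exact_mod_cast le_antisymm hle (Order.one_le_iff_ne_zero.mpr hne)

/-- The Claim in the proof of Lemma 4.4: through any point `p` with `p₁ = 0` of the zero
set `Y` of a prime ideal `P ⊆ ℂ[x₁,…,xₙ]` on which the coordinate `x₁` is nonconstant,
there passes an irreducible algebraic curve `C ⊆ Y` (the zero set of a prime ideal `P' ⊇ P`
whose quotient ring has Krull dimension 1) containing `p`, on which `x₁` is still
nonconstant. -/
theorem curve_through_point_with_nonconstant_coordinate (n : ℕ) (hn : 0 < n)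
    (P : Ideal (MvPolynomial (Fin n) ℂ)) (hP : P.IsPrime)
    (Y : Set (Fin n → ℂ)) (hY : Y = {z | ∀ f ∈ P, MvPolynomial.eval z f = 0})
    (hx1 : ∃ y ∈ Y, ∃ y' ∈ Y, y ⟨0, hn⟩ ≠ y' ⟨0, hn⟩)
    (p : Fin n → ℂ) (hpY : p ∈ Y) (hp1 : p ⟨0, hn⟩ = 0) :
    ∃ P' : Ideal (MvPolynomial (Fin n) ℂ), P'.IsPrime ∧ P ≤ P' ∧
      ringKrullDim (MvPolynomial (Fin n) ℂ ⧸ P') = 1 ∧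
      p ∈ {z : Fin n → ℂ | ∀ f ∈ P', MvPolynomial.eval z f = 0} ∧
      {z : Fin n → ℂ | ∀ f ∈ P', MvPolynomial.eval z f = 0} ⊆ Y ∧
      (∃ y ∈ {z : Fin n → ℂ | ∀ f ∈ P', MvPolynomial.eval z f = 0},
        ∃ y' ∈ {z : Fin n → ℂ | ∀ f ∈ P', MvPolynomial.eval z f = 0},
          y ⟨0, hn⟩ ≠ y' ⟨0, hn⟩) := by
  obtain ⟨y, hy, hy0⟩ : ∃ y ∈ Y, y ⟨0, hn⟩ ≠ 0 := by
    obtain ⟨y, hy, y', hy', hne⟩ := hx1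
    by_cases h : y ⟨0, hn⟩ = 0
    · exact ⟨y', hy', fun h' ↦ hne (h.trans h'.symm)⟩
    · exact ⟨y, hy, h⟩
  subst hY
  have hXP : MvPolynomial.X ⟨0, hn⟩ ∉ P := fun h ↦ hy0 (by simpa using hy _ h)
  obtain ⟨Q, hQ, hPQ, hQm, hXQ, hdim⟩ :=
    Ideal.exists_isPrime_notMem_ringKrullDim_quotient_eq_one ℂ hP
      (inferInstance : (MvPolynomial.vanishingIdeal ℂ {p}).IsMaximal)
      (fun f hf ↦ by simpa using! hpY f hf) (f := MvPolynomial.X ⟨0, hn⟩) (by simpa using hp1) hXP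
  have hpQ : ∀ f ∈ Q, MvPolynomial.eval p f = 0 := fun f hf ↦ by
    simpa using! hQm hf
  refine ⟨Q, hQ, hPQ, hdim, hpQ, fun z hz f hf ↦ hz f (hPQ hf), ?_⟩
  by_contra! hconst
  refine hXQ ?_
  rw [← MvPolynomial.IsPrime.vanishingIdeal_zeroLocus (K := ℂ) Q,
    MvPolynomial.mem_vanishingIdeal_iff]
  intro z hz
  have hzQ : ∀ f ∈ Q, MvPolynomial.eval z f = 0 := fun f hf ↦ by
    simpa [MvPolynomial.aeval_eq_eval] using hz f hf
  simpa [hp1] using hconst z hzQ p hpQ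
end
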